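/- Let a > 0 and c(l,k) as in the Buckley–Osthus recurrences. Then Σ_{l=1}^{∞} c(l,k) = ((a+1)Γ(2a+1)/Γ(a)) · k^{-(a+1)} · (1 + O((ln k)^{⌈a+1⌉}/k)) as k → ∞. -/

import Mathlib

open Real

noncomputable def betaF (x y : ℝ) : ℝ := Real.Gamma x * Real.Gamma y / Real.Gamma (x + y)

open Filter Asymptotics Finset

/-- The ratio `Γ(x + s) / Γ(x)`, a real-exponent version of the rising factorial. -/
noncomputable def gammaRatio (x s : ℝ) : ℝ := Real.Gamma (x + s) / Real.Gamma x

lemma gammaRatio_pos {x s : ℝ} (hx : 0 < x) (hxs : 0 < x + s) : 0 < gammaRatio x s :=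
  div_pos (Real.Gamma_pos_of_pos hxs) (Real.Gamma_pos_of_pos hx)

lemma gammaRatio_zero {x : ℝ} (hx : 0 < x) : gammaRatio x 0 = 1 := by
  rw [gammaRatio, add_zero, div_self (Real.Gamma_pos_of_pos hx).ne']

lemma mul_gammaRatio_add_one_left {x s : ℝ} (hx : 0 < x) (hxs : 0 < x + s) :
    x * gammaRatio (x + 1) s = (x + s) * gammaRatio x s := by
  have h := (Real.Gamma_pos_of_pos hx).ne'
  rw [gammaRatio, gammaRatio, add_right_comm, Real.Gamma_add_one hx.ne',
    Real.Gamma_add_one hxs.ne']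
  field_simp

lemma gammaRatio_add_one_right {x s : ℝ} (hxs : 0 < x + s) :
    gammaRatio x (s + 1) = (x + s) * gammaRatio x s := by
  rw [gammaRatio, gammaRatio, ← add_assoc, Real.Gamma_add_one hxs.ne', mul_div_assoc]

lemma mul_gammaRatio_add_one_sub_one {x s : ℝ} (hx : 0 < x) :
    x * gammaRatio (x + 1) (s - 1) = gammaRatio x s := by
  have h := (Real.Gamma_pos_of_pos hx).ne'
  rw [gammaRatio, gammaRatio, Real.Gamma_add_one hx.ne', show x + 1 + (s - 1) = x + s by ring]
  field_simp

/-- The recurrence solved by `c`, cleared of denominators and with both indices shifted by one;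
`s` is the source term, which enters only at the first value of the first index. -/
structure IsEdgeRecurrence (a : ℝ) (s : ℕ → ℝ) (c : ℕ → ℕ → ℝ) : Prop where
  right_zero : ∀ l, c l 0 = 0
  left_zero : ∀ k, c 0 k = 0
  step : ∀ i j : ℕ, c (i + 1) (j + 1) * (((i : ℝ) + 1) * (1 + a) + (j + 1) + 2 * a) =
    c (i + 1) j * (a * (i + 1) + j) + c i (j + 1) * (i - 1 + a) + if i = 0 then s j else 0

namespace IsEdgeRecurrence

variable {a : ℝ} {s : ℕ → ℝ} {c : ℕ → ℕ → ℝ}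

lemma nonneg (h : IsEdgeRecurrence a s c) (ha : 0 < a) (hs : ∀ j, 0 ≤ s j) (l k : ℕ) :
    0 ≤ c l k := by
  induction l generalizing k with
  | zero => rw [h.left_zero]
  | succ i ihi =>
    induction k with
    | zero => rw [h.right_zero]
    | succ j ihj =>
      have hD : 0 < ((i : ℝ) + 1) * (1 + a) + (j + 1) + 2 * a := by positivity
      refine nonneg_of_mul_nonneg_left (b := ((i : ℝ) + 1) * (1 + a) + (j + 1) + 2 * a) ?_ hD
      rw [h.step]
      have h1 : 0 ≤ c (i + 1) j * (a * (i + 1) + j) := mul_nonneg ihj (by positivity)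
      have h2 : 0 ≤ c i (j + 1) * ((i : ℝ) - 1 + a) := by
        rcases Nat.eq_zero_or_pos i with rfl | hi
        · simp [h.left_zero]
        · have : (1 : ℝ) ≤ i := by exact_mod_cast hi
          exact mul_nonneg (ihi _) (by linarith)
      have h3 : (0 : ℝ) ≤ if i = 0 then s j else 0 := by split_ifs <;> simp [hs]
      linarith

/-- Summation by parts of the recurrence against a weight `V` over a rectangle. -/
lemma sum_mul_weight (h : IsEdgeRecurrence a s c) (V : ℕ → ℕ → ℝ) (L N : ℕ) :
    ∑ i ∈ range L, c (i + 1) N * (a * (i + 1) + N) * V i N +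
      ∑ j ∈ range N, c L (j + 1) * (L - 1 + a) * V L j +
      ∑ j ∈ range N, ∑ i ∈ range L, c (i + 1) (j + 1) *
        ((((i : ℝ) + 1) * (1 + a) + (j + 1) + 2 * a) * V i j -
          (a * (i + 1) + (j + 1)) * V i (j + 1) - (i + a) * V (i + 1) j) =
      ∑ j ∈ range N, if 0 < L then s j * V 0 j else 0 := by
  have shift : ∀ (u : ℕ → ℝ) (n : ℕ), u 0 = 0 →
      ∑ x ∈ range n, u x = ∑ x ∈ range n, u (x + 1) - u n := by
    intro u n hu
    have := (sum_range_succ u n).symm.trans (sum_range_succ' u n)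
    linarith
  have hk : ∑ j ∈ range N, ∑ i ∈ range L, c (i + 1) j * (a * (i + 1) + j) * V i j =
      ∑ j ∈ range N, ∑ i ∈ range L,
        c (i + 1) (j + 1) * (a * (i + 1) + (j + 1)) * V i (j + 1) -
      ∑ i ∈ range L, c (i + 1) N * (a * (i + 1) + N) * V i N := by
    rw [shift (fun j => ∑ i ∈ range L, c (i + 1) j * (a * (i + 1) + j) * V i j) N
      (by simp [h.right_zero])]
    push_cast
    rfl
  have hl : ∑ j ∈ range N, ∑ i ∈ range L, c i (j + 1) * ((i : ℝ) - 1 + a) * V i j =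
      ∑ j ∈ range N, ∑ i ∈ range L, c (i + 1) (j + 1) * (i + a) * V (i + 1) j -
      ∑ j ∈ range N, c L (j + 1) * (L - 1 + a) * V L j := by
    rw [← sum_sub_distrib]
    refine sum_congr rfl fun j _ => ?_
    rw [shift (fun i => c i (j + 1) * ((i : ℝ) - 1 + a) * V i j) L (by simp [h.left_zero])]
    push_cast
    congr 1
    exact sum_congr rfl fun i _ => by ring
  have hs : ∑ j ∈ range N, ∑ i ∈ range L, (if i = 0 then s j else 0) * V i j =
      ∑ j ∈ range N, if 0 < L then s j * V 0 j else 0 := by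
    refine sum_congr rfl fun j _ => ?_
    simp [ite_mul]
  have hmain : ∑ j ∈ range N, ∑ i ∈ range L,
      c (i + 1) (j + 1) * (((i : ℝ) + 1) * (1 + a) + (j + 1) + 2 * a) * V i j =
      ∑ j ∈ range N, ∑ i ∈ range L, c (i + 1) j * (a * (i + 1) + j) * V i j +
      ∑ j ∈ range N, ∑ i ∈ range L, c i (j + 1) * ((i : ℝ) - 1 + a) * V i j +
      ∑ j ∈ range N, ∑ i ∈ range L, (if i = 0 then s j else 0) * V i j := by
    simp only [← sum_add_distrib]
    exact sum_congr rfl fun j _ => sum_congr rfl fun i _ => by rw [h.step]; ring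
  rw [hk, hl, hs] at hmain
  have hsplit : ∑ j ∈ range N, ∑ i ∈ range L, c (i + 1) (j + 1) *
        ((((i : ℝ) + 1) * (1 + a) + (j + 1) + 2 * a) * V i j -
          (a * (i + 1) + (j + 1)) * V i (j + 1) - (i + a) * V (i + 1) j) =
      ∑ j ∈ range N, ∑ i ∈ range L,
        c (i + 1) (j + 1) * (((i : ℝ) + 1) * (1 + a) + (j + 1) + 2 * a) * V i j -
      ∑ j ∈ range N, ∑ i ∈ range L,
        c (i + 1) (j + 1) * (a * (i + 1) + (j + 1)) * V i (j + 1) -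
      ∑ j ∈ range N, ∑ i ∈ range L, c (i + 1) (j + 1) * (i + a) * V (i + 1) j := by
    simp only [← sum_sub_distrib]
    exact sum_congr rfl fun j _ => sum_congr rfl fun i _ => by ring
  linarith

end IsEdgeRecurrence

/-- The weighted row sum `∑_{i < L} c(i+1, N) (a(i+1) + N) Γ(i+a+P)/Γ(i+a) Γ(N+a+2-P)/Γ(N+1)`. -/
noncomputable def rowMoment (a : ℝ) (c : ℕ → ℕ → ℝ) (P L N : ℕ) : ℝ :=
  ∑ i ∈ range L, c (i + 1) N * (a * (i + 1) + N) *
    (gammaRatio (i + a) P * gammaRatio (N + 1) (a + 1 - P))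

/-- The weighted column sum complementary to `rowMoment`. -/
noncomputable def columnMoment (a : ℝ) (c : ℕ → ℕ → ℝ) (P L N : ℕ) : ℝ :=
  ∑ j ∈ range N, c L (j + 1) * (L - 1 + a) *
    (gammaRatio (L + a) P * gammaRatio (j + 1) (a + 1 - P))

/-- The weighted source. -/
noncomputable def sourceMoment (a : ℝ) (s : ℕ → ℝ) (P N : ℕ) : ℝ :=
  ∑ j ∈ range N, s j * (gammaRatio a P * gammaRatio (j + 1) (a + 1 - P))

/-- The error term in the balance equation for the weighted sums. -/
noncomputable def interactionMoment (a : ℝ) (c : ℕ → ℕ → ℝ) (P L N : ℕ) : ℝ :=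
  ∑ j ∈ range N, ∑ i ∈ range L, c (i + 1) (j + 1) * (a * (i + 1) / (j + 1) *
    (gammaRatio (i + a) P * gammaRatio (j + 1) (a + 1 - P)))

namespace IsEdgeRecurrence

variable {a : ℝ} {s : ℕ → ℝ} {c : ℕ → ℕ → ℝ}

lemma balance (h : IsEdgeRecurrence a s c) (ha : 0 < a) {P L : ℕ} (hP : (P : ℝ) < a + 2)
    (hL : 0 < L) (N : ℕ) :
    rowMoment a c P L N + columnMoment a c P L N =
      sourceMoment a s P N + (a + 1 - P) * interactionMoment a c P L N := by
  have key := h.sum_mul_weight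
    (fun i j => gammaRatio (i + a) P * gammaRatio (j + 1) (a + 1 - P)) L N
  have hbr : ∀ i j : ℕ, (((i : ℝ) + 1) * (1 + a) + (j + 1) + 2 * a) *
        (gammaRatio (i + a) P * gammaRatio (j + 1) (a + 1 - P)) -
      (a * (i + 1) + (j + 1)) *
        (gammaRatio (i + a) P * gammaRatio ((j + 1 : ℕ) + 1) (a + 1 - P)) -
      (i + a) * (gammaRatio ((i + 1 : ℕ) + a) P * gammaRatio (j + 1) (a + 1 - P)) =
      -((a + 1 - P) * (a * (i + 1) / (j + 1) *
        (gammaRatio (i + a) P * gammaRatio (j + 1) (a + 1 - P)))) := by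
    intro i j
    have h1 := mul_gammaRatio_add_one_left (x := (i : ℝ) + a) (s := P) (by positivity)
      (by positivity)
    have h2 := mul_gammaRatio_add_one_left (x := (j : ℝ) + 1) (s := a + 1 - P) (by positivity)
      (by have : (0 : ℝ) ≤ j := by positivity
          linarith)
    have e1 : ((i + 1 : ℕ) : ℝ) + a = i + a + 1 := by push_cast; ring
    have e2 : ((j + 1 : ℕ) : ℝ) + 1 = j + 1 + 1 := by push_cast; ring
    rw [e1, e2]
    have hj : (j : ℝ) + 1 ≠ 0 := by positivity
    have h2' : gammaRatio ((j : ℝ) + 1 + 1) (a + 1 - P) =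
        (j + 1 + (a + 1 - P)) * gammaRatio (j + 1) (a + 1 - P) / (j + 1) := by
      rw [← h2]; field_simp
    have hi : (i : ℝ) + a ≠ 0 := by positivity
    have h1' : gammaRatio ((i : ℝ) + a + 1) P =
        (i + a + P) * gammaRatio (i + a) P / (i + a) := by
      rw [← h1]; field_simp
    rw [h1', h2']
    field_simp
    ring
  simp only [hbr, hL, if_true] at key
  rw [rowMoment, columnMoment, sourceMoment, interactionMoment, mul_sum]
  simp only [mul_sum]
  simp only [mul_neg, sum_neg_distrib, Nat.cast_zero, zero_add] at key
  rw [add_neg_eq_iff_eq_add] at key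
  rw [key]
  congr 1
  exact sum_congr rfl fun j _ => sum_congr rfl fun i _ => by ring

lemma interactionMoment_le (h : IsEdgeRecurrence a s c) (ha : 0 < a) (hs : ∀ j, 0 ≤ s j)
    {P : ℕ} (hP : (P : ℝ) < a + 2) (L N : ℕ) :
    interactionMoment a c P L N ≤
      (a + 1) * ∑ j ∈ range N, rowMoment a c (P + 1) L (j + 1) / (j + 1) := by
  rw [interactionMoment, mul_sum]
  refine sum_le_sum fun j _ => ?_
  rw [rowMoment, sum_div, mul_sum]
  refine sum_le_sum fun i _ => ?_
  have hc := h.nonneg ha hs (i + 1) (j + 1)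
  have hj : (0 : ℝ) < j + 1 := by positivity
  have e1 : gammaRatio (i + a) (P + 1 : ℕ) = (i + a + P) * gammaRatio (i + a) P := by
    push_cast
    exact gammaRatio_add_one_right (by positivity)
  have e2 := mul_gammaRatio_add_one_sub_one (x := (j : ℝ) + 1) (s := a + 1 - P) hj
  have hf : 0 < gammaRatio ((i : ℝ) + a) P := gammaRatio_pos (by positivity) (by positivity)
  have hG : 0 < gammaRatio ((j : ℝ) + 1) (a + 1 - P) :=
    gammaRatio_pos hj (by have : (0 : ℝ) ≤ j := by positivity
                          linarith)
  have e3 : gammaRatio ((j + 1 : ℕ) + 1) (a + 1 - (P + 1 : ℕ)) =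
      gammaRatio (j + 1) (a + 1 - P) / (j + 1) := by
    rw [← e2]; push_cast
    rw [show a + 1 - ((P : ℝ) + 1) = a + 1 - P - 1 by ring]; field_simp
  rw [e1, e3]
  have hmul : a * ((i : ℝ) + 1) * (j + 1) ≤
      (a + 1) * ((a * (i + 1) + (j + 1)) * (i + a + P)) := by
    have hi : (0 : ℝ) ≤ i := by positivity
    have hP0 : (0 : ℝ) ≤ P := by positivity
    calc a * ((i : ℝ) + 1) * (j + 1) ≤ ((a + 1) * (i + a + P)) * (a * (i + 1) + (j + 1)) := by
          refine mul_le_mul ?_ ?_ hj.le (by positivity)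
          · nlinarith [mul_nonneg ha.le hP0]
          · nlinarith [mul_nonneg ha.le hi]
      _ = _ := by ring
  set F := gammaRatio ((i : ℝ) + a) P
  set G := gammaRatio ((j : ℝ) + 1) (a + 1 - P)
  have lhs : c (i + 1) (j + 1) * (a * (i + 1) / (j + 1) * (F * G)) =
      (c (i + 1) (j + 1) * F * G / (j + 1) ^ 2) * (a * (i + 1) * (j + 1)) := by
    field_simp
  have rhs : (a + 1) * (c (i + 1) (j + 1) * (a * (i + 1) + (j + 1 : ℕ)) *
      ((i + a + P) * F * (G / (j + 1))) / (j + 1)) =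
      (c (i + 1) (j + 1) * F * G / (j + 1) ^ 2) *
        ((a + 1) * ((a * (i + 1) + (j + 1)) * (i + a + P))) := by
    push_cast; field_simp
  rw [lhs, rhs]
  gcongr

lemma interactionMoment_nonneg (h : IsEdgeRecurrence a s c) (ha : 0 < a) (hs : ∀ j, 0 ≤ s j)
    {P : ℕ} (hP : (P : ℝ) < a + 2) (L N : ℕ) : 0 ≤ interactionMoment a c P L N := by
  refine sum_nonneg fun j _ => sum_nonneg fun i _ => ?_
  have hj : (0 : ℝ) ≤ j := by positivity
  have := gammaRatio_pos (x := (j : ℝ) + 1) (s := a + 1 - P) (by positivity) (by linarith)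
  have := gammaRatio_pos (x := (i : ℝ) + a) (s := P) (by positivity) (by positivity)
  have := h.nonneg ha hs (i + 1) (j + 1)
  positivity

lemma columnMoment_nonneg (h : IsEdgeRecurrence a s c) (ha : 0 < a) (hs : ∀ j, 0 ≤ s j)
    {P L : ℕ} (hP : (P : ℝ) < a + 2) (hL : 0 < L) (N : ℕ) : 0 ≤ columnMoment a c P L N := by
  refine sum_nonneg fun j _ => ?_
  have hj : (0 : ℝ) ≤ j := by positivity
  have := gammaRatio_pos (x := (j : ℝ) + 1) (s := a + 1 - P) (by positivity) (by linarith)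
  have := gammaRatio_pos (x := (L : ℝ) + a) (s := P) (by positivity) (by positivity)
  have := h.nonneg ha hs L (j + 1)
  have hL1 : (1 : ℝ) ≤ L := by exact_mod_cast hL
  have : 0 ≤ (L : ℝ) - 1 + a := by linarith
  positivity

end IsEdgeRecurrence

lemma isBigO_mul_sub_one {f h g : ℕ → ℝ} (hg : Tendsto g atTop (nhds 0))
    (hf : (fun n => f n - 1) =O[atTop] g) (hh : (fun n => h n - 1) =O[atTop] g) :
    (fun n => f n * h n - 1) =O[atTop] g := by
  have hh1 : h =O[atTop] (fun _ => (1 : ℝ)) := by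
    have := (hh.trans_tendsto hg).add_const 1
    simp only [sub_add_cancel] at this
    exact this.isBigO_one ℝ
  have := (hf.mul hh1).add (hh.trans (by simpa using isBigO_refl g atTop))
  simp only [mul_one] at this
  exact this.congr_left fun n => by ring

lemma isBigO_inv_sub_one {f g : ℕ → ℝ} (hg : Tendsto g atTop (nhds 0))
    (hf : (fun n => f n - 1) =O[atTop] g) :
    (fun n => (f n)⁻¹ - 1) =O[atTop] g := by
  have hf1 : Tendsto f atTop (nhds 1) := by
    have := (hf.trans_tendsto hg).add_const 1
    simpa only [sub_add_cancel, zero_add] using this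
  have hinv := (hf1.inv₀ one_ne_zero).isBigO_one ℝ
  have := (hf.mul hinv).neg_left
  simp only [mul_one] at this
  refine this.congr' ?_ EventuallyEq.rfl
  filter_upwards [hf1.eventually_ne one_ne_zero] with n hn
  field_simp
  ring

/-- Wendel's inequalities. -/
lemma gammaRatio_div_rpow_mem_Icc {x s : ℝ} (hx : 0 < x) (hs0 : 0 < s) (hs1 : s < 1) :
    gammaRatio x s / x ^ s ∈ Set.Icc (1 - s / x) 1 := by
  have hG := Real.Gamma_pos_of_pos hx
  have hxs : 0 < x + s := by positivity
  have hGs := Real.Gamma_pos_of_pos hxs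
  have hpow : 0 < x ^ s := by positivity
  constructor
  · have h := Real.Gamma_mul_add_mul_le_rpow_Gamma_mul_rpow_Gamma (s := x + s) (t := x + s + 1)
      (a := s) (b := 1 - s) hxs (by positivity) hs0 (by linarith) (by ring)
    rw [show s * (x + s) + (1 - s) * (x + s + 1) = x + 1 by ring, Real.Gamma_add_one hx.ne',
      Real.Gamma_add_one hxs.ne', Real.mul_rpow hxs.le hGs.le, mul_left_comm,
      ← Real.rpow_add hGs, add_sub_cancel, Real.rpow_one] at h
    have hstep : 1 - s / x ≤ (x / (x + s)) ^ (1 - s) := by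
      have hb : x / (x + s) ≤ 1 := by rw [div_le_one hxs]; linarith
      calc 1 - s / x ≤ x / (x + s) := by
            rw [le_div_iff₀ hxs]
            field_simp
            nlinarith
        _ = (x / (x + s)) ^ (1 : ℝ) := (Real.rpow_one _).symm
        _ ≤ _ := Real.rpow_le_rpow_of_exponent_ge (by positivity) hb (by linarith)
    refine hstep.trans ?_
    rw [Real.div_rpow hx.le hxs.le, gammaRatio, div_div, div_le_div_iff₀ (by positivity)
      (by positivity)]
    calc x ^ (1 - s) * (Real.Gamma x * x ^ s) = x ^ (1 - s) * x ^ s * Real.Gamma x := by ring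
      _ = x * Real.Gamma x := by rw [← Real.rpow_add hx]; simp
      _ ≤ _ := by linarith
  · have h := Real.Gamma_mul_add_mul_le_rpow_Gamma_mul_rpow_Gamma (s := x) (t := x + 1)
      (a := 1 - s) (b := s) hx (by positivity) (by linarith) hs0 (by ring)
    rw [show (1 - s) * x + s * (x + 1) = x + s by ring, Real.Gamma_add_one hx.ne',
      Real.mul_rpow hx.le hG.le, mul_left_comm, ← Real.rpow_add hG, sub_add_cancel,
      Real.rpow_one] at h
    rw [gammaRatio, div_div, div_le_one (by positivity)]
    linarith

lemma gammaRatio_div_rpow_sub_one_isBigO {s : ℝ} (hs : 0 ≤ s) :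
    (fun n : ℕ => gammaRatio n s / (n : ℝ) ^ s - 1) =O[atTop] fun n : ℕ => 1 / (n : ℝ) := by
  have base : ∀ t : ℝ, 0 ≤ t → t < 1 →
      (fun n : ℕ => gammaRatio n t / (n : ℝ) ^ t - 1) =O[atTop] fun n : ℕ => 1 / (n : ℝ) := by
    intro t ht0 ht1
    refine IsBigO.of_bound 1 ?_
    filter_upwards [eventually_gt_atTop 0] with n hn
    have hn' : (0 : ℝ) < n := by exact_mod_cast hn
    rcases ht0.eq_or_lt with rfl | ht0
    · simp [gammaRatio_zero hn']
    · obtain ⟨h1, h2⟩ := gammaRatio_div_rpow_mem_Icc hn' ht0 ht1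
      have h3 : t / n ≤ 1 / n := by gcongr
      rw [Real.norm_eq_abs, Real.norm_eq_abs, abs_of_pos (show (0 : ℝ) < 1 / n by positivity),
        abs_le]
      constructor <;> linarith [show (0 : ℝ) < 1 / n by positivity]
  have step : ∀ m : ℕ, (fun n : ℕ => gammaRatio n (Int.fract s + m) /
      (n : ℝ) ^ (Int.fract s + m) - 1) =O[atTop] fun n : ℕ => 1 / (n : ℝ) := by
    intro m
    induction m with
    | zero => simpa using base _ (Int.fract_nonneg s) (Int.fract_lt_one s)
    | succ m ih =>
      set t := Int.fract s + (m : ℝ) with ht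
      have ht0 : 0 ≤ t := add_nonneg (Int.fract_nonneg s) (by positivity)
      have hlin : (fun n : ℕ => (1 + t * (1 / (n : ℝ))) - 1) =O[atTop]
          fun n : ℕ => 1 / (n : ℝ) := by
        simpa only [add_sub_cancel_left] using
          (isBigO_refl (fun n : ℕ => 1 / (n : ℝ)) atTop).const_mul_left t
      refine (isBigO_mul_sub_one tendsto_one_div_atTop_nhds_zero_nat ih hlin).congr' ?_ EventuallyEq.rfl
      filter_upwards [eventually_gt_atTop 0] with n hn
      have hn' : (0 : ℝ) < n := by exact_mod_cast hn
      rw [show Int.fract s + ((m + 1 : ℕ) : ℝ) = t + 1 by rw [ht]; push_cast; ring,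
        gammaRatio_add_one_right (by positivity), Real.rpow_add_one hn'.ne']
      field_simp
  have hfl : Int.fract s + ((⌊s⌋.toNat : ℕ) : ℝ) = s := by
    have : ((⌊s⌋.toNat : ℤ) : ℝ) = (⌊s⌋ : ℝ) := by
      rw [Int.toNat_of_nonneg (Int.floor_nonneg.mpr hs)]
    rw [← Int.cast_natCast, this, Int.fract_add_floor]
  have := step ⌊s⌋.toNat
  rwa [hfl] at this

/-- The leading constant. -/
noncomputable def leadingConst (a : ℝ) : ℝ := (a + 1) * Real.Gamma (2 * a + 1) / Real.Gamma a

/-- The source term of the recurrence, in closed form. -/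
noncomputable def sourceTerm (a : ℝ) (j : ℕ) : ℝ :=
  leadingConst a * (Real.Gamma (j + 1 + a) / Real.Gamma (j + 2 + 2 * a))

lemma leadingConst_pos {a : ℝ} (ha : 0 < a) : 0 < leadingConst a := by
  have := Real.Gamma_pos_of_pos ha
  have := Real.Gamma_pos_of_pos (show 0 < 2 * a + 1 by positivity)
  unfold leadingConst
  positivity

lemma sourceTerm_pos {a : ℝ} (ha : 0 < a) (j : ℕ) : 0 < sourceTerm a j := by
  have := leadingConst_pos ha
  have := Real.Gamma_pos_of_pos (show 0 < j + 1 + a by positivity)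
  have := Real.Gamma_pos_of_pos (show 0 < j + 2 + 2 * a by positivity)
  unfold sourceTerm
  positivity

lemma exists_abs_sourceTerm_mul_sub_le {a : ℝ} (ha : 0 < a) :
    ∃ K > 0, ∀ j : ℕ,
      |sourceTerm a j * gammaRatio (j + 1) (a + 1) - leadingConst a| ≤ K * (1 / (j + 1)) := by
  have hC := leadingConst_pos ha
  have hO := isBigO_mul_sub_one tendsto_one_div_atTop_nhds_zero_nat
    (isBigO_mul_sub_one tendsto_one_div_atTop_nhds_zero_nat
      (gammaRatio_div_rpow_sub_one_isBigO ha.le)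
      (gammaRatio_div_rpow_sub_one_isBigO (show 0 ≤ a + 1 by positivity)))
    (isBigO_inv_sub_one tendsto_one_div_atTop_nhds_zero_nat
      (gammaRatio_div_rpow_sub_one_isBigO (show 0 ≤ a + (a + 1) by positivity)))
  obtain ⟨K, hK, hb⟩ := bound_of_isBigO_nat_atTop hO
  refine ⟨leadingConst a * K, by positivity, fun j => ?_⟩
  have hj : (0 : ℝ) < j + 1 := by positivity
  have h := hb (x := j + 1) (by positivity)
  rw [Real.norm_eq_abs, Real.norm_eq_abs,
    abs_of_pos (show (0 : ℝ) < 1 / ((j + 1 : ℕ) : ℝ) by positivity)] at h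
  push_cast at h
  have key : sourceTerm a j * gammaRatio (j + 1) (a + 1) - leadingConst a =
      leadingConst a * (gammaRatio (j + 1) a / ((j : ℝ) + 1) ^ a *
        (gammaRatio (j + 1) (a + 1) / ((j : ℝ) + 1) ^ (a + 1)) *
        (gammaRatio (j + 1) (a + (a + 1)) / ((j : ℝ) + 1) ^ (a + (a + 1)))⁻¹ - 1) := by
    have h1 := (Real.Gamma_pos_of_pos hj).ne'
    have h2 := (Real.Gamma_pos_of_pos (show 0 < (j : ℝ) + 2 + 2 * a by positivity)).ne'
    rw [sourceTerm, Real.rpow_add hj a (a + 1)]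
    simp only [gammaRatio]
    rw [show (j : ℝ) + 1 + (a + (a + 1)) = j + 2 + 2 * a by ring]
    have h3 : ((j : ℝ) + 1) ^ a ≠ 0 := by positivity
    have h4 : ((j : ℝ) + 1) ^ (a + 1) ≠ 0 := by positivity
    field_simp
  rw [key, abs_mul, abs_of_pos hC, mul_assoc (leadingConst a) K]
  gcongr

lemma exists_sourceTerm_mul_le {a : ℝ} (ha : 0 < a) (P : ℕ) (hP : (P : ℝ) < a + 2) :
    ∃ K > 0, ∀ j : ℕ,
      sourceTerm a j * gammaRatio (j + 1) (a + 1 - P) ≤ K * (1 / ((j : ℝ) + 1) ^ P) := by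
  induction P with
  | zero =>
    obtain ⟨K, hK, h⟩ := exists_abs_sourceTerm_mul_sub_le ha
    refine ⟨leadingConst a + K, add_pos (leadingConst_pos ha) hK, fun j => ?_⟩
    have h1 := (abs_le.1 (h j)).2
    have h2 : K * (1 / ((j : ℝ) + 1)) ≤ K * 1 := by
      gcongr
      rw [div_le_one (by positivity)]
      linarith [show (0 : ℝ) ≤ j by positivity]
    simp only [Nat.cast_zero, sub_zero, pow_zero]
    linarith
  | succ P ih =>
    push_cast at hP
    obtain ⟨K, hK, h⟩ := ih (by linarith)
    set δ := min 1 (a + 1 - P) with hδ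
    have hδ0 : 0 < δ := lt_min one_pos (by linarith)
    refine ⟨K / δ, by positivity, fun j => ?_⟩
    have hj0 : (0 : ℝ) ≤ j := by positivity
    have hxs : 0 < (j : ℝ) + 1 + (a + 1 - (P + 1 : ℕ)) := by push_cast; linarith
    have e := gammaRatio_add_one_right hxs
    rw [show a + 1 - ((P + 1 : ℕ) : ℝ) + 1 = a + 1 - P by push_cast; ring] at e
    have hG := gammaRatio_pos (show (0 : ℝ) < j + 1 by positivity) hxs
    have hS := sourceTerm_pos ha j
    have hlow : δ * (j + 1) ≤ (j : ℝ) + 1 + (a + 1 - (P + 1 : ℕ)) := by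
      have h1 : δ ≤ 1 := min_le_left _ _
      have h2 : δ ≤ a + 1 - P := min_le_right _ _
      push_cast
      nlinarith
    have hj := h j
    rw [e] at hj
    have hfin : sourceTerm a j * ((δ * (j + 1)) * gammaRatio (j + 1) (a + 1 - (P + 1 : ℕ))) ≤
        K * (1 / ((j : ℝ) + 1) ^ P) := le_trans (by gcongr) hj
    rw [pow_succ]
    calc sourceTerm a j * gammaRatio (j + 1) (a + 1 - (P + 1 : ℕ))
        = sourceTerm a j * ((δ * (j + 1)) * gammaRatio (j + 1) (a + 1 - (P + 1 : ℕ))) /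
            (δ * (j + 1)) := by field_simp
      _ ≤ K * (1 / ((j : ℝ) + 1) ^ P) / (δ * (j + 1)) := by gcongr
      _ = _ := by field_simp

/-- The partial sums of the harmonic series. -/
noncomputable def harmonicSum (N : ℕ) : ℝ := ∑ j ∈ range N, 1 / ((j : ℝ) + 1)

lemma harmonicSum_mono {M N : ℕ} (h : M ≤ N) : harmonicSum M ≤ harmonicSum N :=
  sum_le_sum_of_subset_of_nonneg (range_subset_range.2 h) fun _ _ _ => by positivity

lemma one_le_harmonicSum {N : ℕ} (hN : 0 < N) : 1 ≤ harmonicSum N := by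
  simpa [harmonicSum] using harmonicSum_mono (Nat.succ_le_of_lt hN)

lemma harmonicSum_le_one_add_log (N : ℕ) : harmonicSum N ≤ 1 + Real.log N := by
  have h := harmonic_le_one_add_log N
  simpa [harmonic, harmonicSum] using h

lemma sum_one_div_sq_le_two (N : ℕ) : ∑ j ∈ range N, 1 / ((j : ℝ) + 1) ^ 2 ≤ 2 := by
  have h : ∀ n : ℕ, ∑ j ∈ range (n + 1), 1 / ((j : ℝ) + 1) ^ 2 ≤ 2 - 1 / ((n : ℝ) + 1) := by
    intro n
    induction n with
    | zero => norm_num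
    | succ n ih =>
      rw [sum_range_succ]
      have hstep : 1 / (((n + 1 : ℕ) : ℝ) + 1) ^ 2 + 1 / (((n + 1 : ℕ) : ℝ) + 1) ≤
          1 / ((n : ℝ) + 1) := by
        push_cast
        rw [div_add_div _ _ (by positivity) (by positivity), div_le_div_iff₀ (by positivity)
          (by positivity)]
        have : (0 : ℝ) ≤ n := by positivity
        nlinarith [mul_nonneg this this]
      linarith
  rcases N with _ | n
  · simp
  · linarith [h n, show (0 : ℝ) < 1 / ((n : ℝ) + 1) by positivity]

lemma exists_sourceMoment_le {a : ℝ} (ha : 0 < a) {P m : ℕ} (hP : (P : ℝ) < a + 2)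
    (hP1 : 1 ≤ P) (hm : 2 ≤ P ∨ 1 ≤ m) :
    ∃ K > 0, ∀ N, 0 < N → sourceMoment a (sourceTerm a) P N ≤ K * harmonicSum N ^ m := by
  obtain ⟨K, hK, h⟩ := exists_sourceTerm_mul_le ha P hP
  have hf : 0 < gammaRatio a P := gammaRatio_pos ha (by positivity)
  refine ⟨gammaRatio a P * K * 2, by positivity, fun N hN => ?_⟩
  have hψ := one_le_harmonicSum hN
  have hle : sourceMoment a (sourceTerm a) P N ≤
      gammaRatio a P * K * ∑ j ∈ range N, 1 / ((j : ℝ) + 1) ^ P := by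
    rw [sourceMoment, mul_sum]
    refine sum_le_sum fun j _ => ?_
    rw [mul_left_comm, mul_assoc]
    exact mul_le_mul_of_nonneg_left (h j) hf.le
  refine hle.trans ?_
  rw [mul_assoc _ (2 : ℝ)]
  gcongr
  rcases hm with hm | hm
  · calc ∑ j ∈ range N, 1 / ((j : ℝ) + 1) ^ P ≤ ∑ j ∈ range N, 1 / ((j : ℝ) + 1) ^ 2 := by
          gcongr with j
          linarith [show (0 : ℝ) ≤ j by positivity]
      _ ≤ 2 := sum_one_div_sq_le_two N
      _ ≤ _ := by linarith [one_le_pow₀ hψ (n := m)]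
  · calc ∑ j ∈ range N, 1 / ((j : ℝ) + 1) ^ P ≤ ∑ j ∈ range N, 1 / ((j : ℝ) + 1) ^ 1 := by
          gcongr with j
          linarith [show (0 : ℝ) ≤ j by positivity]
      _ = harmonicSum N ^ 1 := by simp [harmonicSum]
      _ ≤ harmonicSum N ^ m := pow_le_pow_right₀ hψ hm
      _ ≤ _ := by linarith [one_le_pow₀ hψ (n := m)]

lemma abs_sourceMoment_zero_sub_le {a K : ℝ} (ha : 0 < a)
    (hK : ∀ j : ℕ,
      |sourceTerm a j * gammaRatio (j + 1) (a + 1) - leadingConst a| ≤ K * (1 / (j + 1)))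
    (N : ℕ) :
    |sourceMoment a (sourceTerm a) 0 N - leadingConst a * N| ≤ K * harmonicSum N := by
  have e : sourceMoment a (sourceTerm a) 0 N - leadingConst a * N =
      ∑ j ∈ range N, (sourceTerm a j * gammaRatio (j + 1) (a + 1) - leadingConst a) := by
    rw [sum_sub_distrib, sourceMoment]
    simp [gammaRatio_zero ha, mul_comm]
  rw [e, harmonicSum, mul_sum]
  exact (abs_sum_le_sum_abs _ _).trans (sum_le_sum fun j _ => hK j)

lemma sum_rowMoment_div_le {a : ℝ} {c : ℕ → ℕ → ℝ} {P m L : ℕ} {K : ℝ} (hK : 0 ≤ K)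
    (h : ∀ N, 0 < N → rowMoment a c P L N ≤ K * harmonicSum N ^ m) (N : ℕ) :
    ∑ j ∈ range N, rowMoment a c P L (j + 1) / (j + 1) ≤ K * harmonicSum N ^ (m + 1) := by
  calc ∑ j ∈ range N, rowMoment a c P L (j + 1) / (j + 1)
      ≤ ∑ j ∈ range N, K * harmonicSum N ^ m * (1 / ((j : ℝ) + 1)) := by
        refine sum_le_sum fun j hj => ?_
        rw [div_eq_mul_one_div]
        refine mul_le_mul_of_nonneg_right ((h _ j.succ_pos).trans ?_) (by positivity)
        have h0 : 0 ≤ harmonicSum (j + 1) := zero_le_one.trans (one_le_harmonicSum j.succ_pos)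
        have := harmonicSum_mono (mem_range.1 hj)
        gcongr
    _ = K * harmonicSum N ^ (m + 1) := by
        rw [← mul_sum, pow_succ, mul_assoc]
        rfl

namespace IsEdgeRecurrence

variable {a : ℝ} {c : ℕ → ℕ → ℝ}

lemma exists_rowMoment_le (h : IsEdgeRecurrence a (sourceTerm a) c) (ha : 0 < a) (m : ℕ) :
    ∀ P : ℕ, 1 ≤ P → P + m = ⌈a⌉₊ + 1 →
      ∃ K > 0, ∀ L N, 0 < L → 0 < N → rowMoment a c P L N ≤ K * harmonicSum N ^ m := by
  have hs : ∀ j, 0 ≤ sourceTerm a j := fun j => (sourceTerm_pos ha j).le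
  have hn : 0 < ⌈a⌉₊ := Nat.ceil_pos.2 ha
  have hceil : (⌈a⌉₊ : ℝ) < a + 1 := Nat.ceil_lt_add_one ha.le
  induction m with
  | zero =>
    rintro P hP1 hPm
    obtain rfl : P = ⌈a⌉₊ + 1 := hPm
    have hP : ((⌈a⌉₊ + 1 : ℕ) : ℝ) < a + 2 := by push_cast; linarith
    obtain ⟨K, hK, hsrc⟩ := exists_sourceMoment_le ha hP hP1 (m := 0) (Or.inl (by omega))
    refine ⟨K, hK, fun L N hL hN => ?_⟩
    have hb := h.balance ha hP hL N
    have h1 := h.columnMoment_nonneg ha hs hP hL N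
    have h2 := h.interactionMoment_nonneg ha hs hP L N
    have h3 : a + 1 - ((⌈a⌉₊ + 1 : ℕ) : ℝ) ≤ 0 := by
      push_cast
      linarith [Nat.le_ceil a]
    have h4 := mul_nonpos_of_nonpos_of_nonneg h3 h2
    linarith [hsrc N hN]
  | succ m ih =>
    rintro P hP1 hPm
    have hPle : (P : ℝ) ≤ ⌈a⌉₊ := by exact_mod_cast (show P ≤ ⌈a⌉₊ by omega)
    have hP : (P : ℝ) < a + 2 := by linarith
    obtain ⟨K, hK, hsrc⟩ := exists_sourceMoment_le ha hP hP1 (m := m + 1) (Or.inr (by omega))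
    obtain ⟨K', hK', hrow⟩ := ih (P + 1) (by omega) (by omega)
    have hβ : 0 < a + 1 - (P : ℝ) := by linarith
    refine ⟨K + (a + 1 - P) * ((a + 1) * K'), by positivity, fun L N hL hN => ?_⟩
    have hb := h.balance ha hP hL N
    have h1 := h.columnMoment_nonneg ha hs hP hL N
    have h2 := h.interactionMoment_le ha hs hP L N
    have h3 := sum_rowMoment_div_le hK'.le (fun N hN => hrow L N hL hN) N
    have h4 : (a + 1 - P) * interactionMoment a c P L N ≤
        (a + 1 - P) * ((a + 1) * (K' * harmonicSum N ^ (m + 1))) := by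
      gcongr
      exact h2.trans (by gcongr)
    linarith [hsrc N hN]

lemma sum_mul_index_le (h : IsEdgeRecurrence a (sourceTerm a) c) (ha : 0 < a) (L : ℕ) {N : ℕ}
    (hN : 0 < N) :
    a * (∑ i ∈ range L, c (i + 1) N * (i + 1)) * gammaRatio (N + 1) (a + 1) ≤
      (a + 2) * (a + 1) * rowMoment a c 1 L N := by
  have hN1 : (1 : ℝ) ≤ N := by exact_mod_cast hN
  rw [rowMoment, mul_sum, mul_sum, sum_mul]
  refine sum_le_sum fun i _ => ?_
  have hc := h.nonneg ha (fun j => (sourceTerm_pos ha j).le) (i + 1) N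
  have e1 : gammaRatio (i + a) (1 : ℕ) = i + a := by
    have := gammaRatio_add_one_right (x := (i : ℝ) + a) (s := 0) (by positivity)
    rwa [gammaRatio_zero (by positivity), zero_add, add_zero, mul_one, ← Nat.cast_one] at this
  have e2 := gammaRatio_add_one_right (x := (N : ℝ) + 1) (s := a) (by positivity)
  have hG : 0 < gammaRatio ((N : ℝ) + 1) a := gammaRatio_pos (by positivity) (by positivity)
  rw [e1, e2, Nat.cast_one, add_sub_cancel_right]
  have hi : (0 : ℝ) ≤ i := by positivity
  have h1 : (N : ℝ) + 1 + a ≤ (a + 2) * (a * (i + 1) + N) := by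
    nlinarith [mul_nonneg ha.le hi, mul_nonneg ha.le (mul_nonneg ha.le hi)]
  have h2 : a * ((i : ℝ) + 1) ≤ (a + 1) * (i + a) := by nlinarith
  calc a * (c (i + 1) N * (i + 1)) * ((N + 1 + a) * gammaRatio (N + 1) a)
      = c (i + 1) N * gammaRatio (N + 1) a * ((a * (i + 1)) * (N + 1 + a)) := by ring
    _ ≤ c (i + 1) N * gammaRatio (N + 1) a *
        (((a + 1) * (i + a)) * ((a + 2) * (a * (i + 1) + N))) := by gcongr
    _ = _ := by ring

lemma summable_mul_index (h : IsEdgeRecurrence a (sourceTerm a) c) (ha : 0 < a) {N : ℕ}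
    (hN : 0 < N) : Summable fun i : ℕ => c (i + 1) N * ((i : ℝ) + 1) := by
  have hc := h.nonneg ha (fun j => (sourceTerm_pos ha j).le)
  obtain ⟨K, hK, hrow⟩ := h.exists_rowMoment_le ha ⌈a⌉₊ 1 le_rfl (add_comm _ _)
  have hG : 0 < gammaRatio ((N : ℝ) + 1) (a + 1) :=
    gammaRatio_pos (by positivity) (by positivity)
  have hψ := zero_le_one.trans (one_le_harmonicSum hN)
  refine summable_of_sum_range_le
    (c := (a + 2) * (a + 1) * (K * harmonicSum N ^ ⌈a⌉₊) / (a * gammaRatio (N + 1) (a + 1)))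
    (fun i => mul_nonneg (hc _ _) (by positivity)) fun L => ?_
  rw [le_div_iff₀ (by positivity)]
  rcases Nat.eq_zero_or_pos L with rfl | hL
  · simp only [range_zero, sum_empty, zero_mul]
    positivity
  · have h1 := h.sum_mul_index_le ha L hN
    have h2 : (a + 2) * (a + 1) * rowMoment a c 1 L N ≤
        (a + 2) * (a + 1) * (K * harmonicSum N ^ ⌈a⌉₊) := by
      gcongr
      exact hrow L N hL hN
    linarith

lemma tendsto_columnMoment (h : IsEdgeRecurrence a (sourceTerm a) c) (ha : 0 < a) (N : ℕ) :
    Tendsto (fun L : ℕ => columnMoment a c 0 L N) atTop (nhds 0) := by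
  have hc := h.nonneg ha (fun j => (sourceTerm_pos ha j).le)
  rw [← tendsto_add_atTop_iff_nat 1]
  simp only [columnMoment]
  rw [show (0 : ℝ) = ∑ j ∈ range N, (0 : ℝ) by simp]
  refine tendsto_finsetSum _ fun j _ => ?_
  have hlim := (h.summable_mul_index ha j.succ_pos).tendsto_atTop_zero
  have hlim' : Tendsto (fun i : ℕ => c (i + 1) (j + 1) * (((i + 1 : ℕ) : ℝ) - 1 + a)) atTop
      (nhds 0) := by
    refine squeeze_zero (g := fun i : ℕ => (1 + a) * (c (i + 1) (j + 1) * ((i : ℝ) + 1)))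
      (fun i => mul_nonneg (hc _ _) (by push_cast; linarith [show (0 : ℝ) ≤ i by positivity]))
      (fun i => ?_) (by simpa using hlim.const_mul (1 + a))
    have := hc (i + 1) (j + 1)
    rw [mul_left_comm]
    gcongr
    push_cast
    nlinarith [show (0 : ℝ) ≤ i by positivity]
  refine (by simpa using hlim'.mul_const (gammaRatio ((j : ℝ) + 1) (a + 1)) : Tendsto
    (fun i : ℕ => c (i + 1) (j + 1) * (((i + 1 : ℕ) : ℝ) - 1 + a) *
      gammaRatio ((j : ℝ) + 1) (a + 1)) atTop (nhds 0)).congr fun i => ?_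
  rw [Nat.cast_zero, gammaRatio_zero (by positivity), sub_zero, one_mul]

lemma exists_abs_tsum_mul_sub_le (h : IsEdgeRecurrence a (sourceTerm a) c) (ha : 0 < a) :
    ∃ K > 0, ∀ N : ℕ, 0 < N →
      |(∑' l, c l N) * (N * gammaRatio (N + 1) (a + 1)) - leadingConst a * N| ≤
        K * harmonicSum N ^ (⌈a⌉₊ + 1) := by
  have hs : ∀ j, 0 ≤ sourceTerm a j := fun j => (sourceTerm_pos ha j).le
  have hc := h.nonneg ha hs
  obtain ⟨K₁, hK₁, hrow⟩ := h.exists_rowMoment_le ha ⌈a⌉₊ 1 le_rfl (add_comm _ _)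
  obtain ⟨K₀, hK₀, hsrc⟩ := exists_abs_sourceTerm_mul_sub_le ha
  refine ⟨(a + 2) * (a + 1) * K₁ + K₀ + (a + 1) * ((a + 1) * K₁), by positivity,
    fun N hN => ?_⟩
  have hψ := one_le_harmonicSum hN
  have hG : 0 < gammaRatio ((N : ℝ) + 1) (a + 1) :=
    gammaRatio_pos (by positivity) (by positivity)
  have hP : ((0 : ℕ) : ℝ) < a + 2 := by simp only [Nat.cast_zero]; positivity
  have hfin : ∀ L : ℕ, 0 < L →
      |(∑ i ∈ range L, c (i + 1) N) * (N * gammaRatio (N + 1) (a + 1)) - leadingConst a * N| ≤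
        ((a + 2) * (a + 1) * K₁ + K₀ + (a + 1) * ((a + 1) * K₁)) *
          harmonicSum N ^ (⌈a⌉₊ + 1) + columnMoment a c 0 L N := by
    intro L hL
    have hb := h.balance ha hP hL N
    have hrow0 : rowMoment a c 0 L N =
        (∑ i ∈ range L, c (i + 1) N) * (N * gammaRatio (N + 1) (a + 1)) +
          a * (∑ i ∈ range L, c (i + 1) N * (i + 1)) * gammaRatio (N + 1) (a + 1) := by
      rw [rowMoment, mul_sum, sum_mul, sum_mul, ← sum_add_distrib]
      refine sum_congr rfl fun i _ => ?_
      rw [Nat.cast_zero, gammaRatio_zero (by positivity), sub_zero]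
      ring
    have hM := h.sum_mul_index_le ha L hN
    have hM0 : 0 ≤ a * (∑ i ∈ range L, c (i + 1) N * (i + 1)) * gammaRatio (N + 1) (a + 1) :=
      mul_nonneg (mul_nonneg ha.le (sum_nonneg fun i _ => mul_nonneg (hc _ _) (by positivity)))
        hG.le
    have hR := hrow L N hL hN
    have hpow : harmonicSum N ^ ⌈a⌉₊ ≤ harmonicSum N ^ (⌈a⌉₊ + 1) :=
      pow_le_pow_right₀ hψ (Nat.le_succ _)
    have hpow1 : harmonicSum N ≤ harmonicSum N ^ (⌈a⌉₊ + 1) := by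
      simpa using pow_le_pow_right₀ hψ (show 1 ≤ ⌈a⌉₊ + 1 by omega)
    have hM' : (a + 2) * (a + 1) * rowMoment a c 1 L N ≤
        (a + 2) * (a + 1) * (K₁ * harmonicSum N ^ (⌈a⌉₊ + 1)) := by
      gcongr
      exact hR.trans (by gcongr)
    have hS := abs_le.1 (abs_sourceMoment_zero_sub_le ha hsrc N)
    have hS' : K₀ * harmonicSum N ≤ K₀ * harmonicSum N ^ (⌈a⌉₊ + 1) := by gcongr
    have hI0 := h.interactionMoment_nonneg ha hs hP L N
    have hI := h.interactionMoment_le ha hs hP L N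
    have hI1 := sum_rowMoment_div_le hK₁.le (fun N hN => hrow L N hL hN) N
    have hI' : (a + 1) * interactionMoment a c 0 L N ≤
        (a + 1) * ((a + 1) * (K₁ * harmonicSum N ^ (⌈a⌉₊ + 1))) := by
      gcongr
      exact hI.trans (by gcongr)
    have hI0' : 0 ≤ (a + 1) * interactionMoment a c 0 L N := by positivity
    have hW := h.columnMoment_nonneg ha hs hP hL N
    rw [Nat.cast_zero, sub_zero, hrow0] at hb
    have hpos1 : 0 ≤ (a + 2) * (a + 1) * (K₁ * harmonicSum N ^ (⌈a⌉₊ + 1)) := by positivity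
    have hpos2 : 0 ≤ (a + 1) * ((a + 1) * (K₁ * harmonicSum N ^ (⌈a⌉₊ + 1))) := by positivity
    rw [abs_le]
    constructor <;> linarith [hS.1, hS.2]
  have hsum : Summable fun i : ℕ => c (i + 1) N := by
    refine Summable.of_nonneg_of_le (fun i => hc _ _) (fun i => ?_) (h.summable_mul_index ha hN)
    exact le_mul_of_one_le_right (hc _ _) (by linarith [show (0 : ℝ) ≤ i by positivity])
  have htsum : ∑' l, c l N = ∑' i, c (i + 1) N := by
    rw [((summable_nat_add_iff 1).1 hsum).tsum_eq_zero_add, h.left_zero, zero_add]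
  have hbound := (h.tendsto_columnMoment ha N).const_add
    (((a + 2) * (a + 1) * K₁ + K₀ + (a + 1) * ((a + 1) * K₁)) * harmonicSum N ^ (⌈a⌉₊ + 1))
  rw [add_zero] at hbound
  rw [htsum]
  refine le_of_tendsto_of_tendsto
    ((hsum.hasSum.tendsto_sum_nat.mul_const _).sub_const _).abs hbound ?_
  filter_upwards [eventually_gt_atTop 0] with L hL using hfin L hL

end IsEdgeRecurrence

lemma betaF_ratio_mul {a : ℝ} (ha : 0 < a) (j : ℕ) :
    betaF (j + a) (a + 2) / betaF a (a + 1) * (a + j) = sourceTerm a j := by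
  have h1 := (Real.Gamma_pos_of_pos ha).ne'
  have h2 := (Real.Gamma_pos_of_pos (show 0 < a + 1 by positivity)).ne'
  have h3 := (Real.Gamma_pos_of_pos (show 0 < 2 * a + 1 by positivity)).ne'
  have h4 := (Real.Gamma_pos_of_pos (show 0 < j + 2 + 2 * a by positivity)).ne'
  have e1 : Real.Gamma (a + 2) = (a + 1) * Real.Gamma (a + 1) := by
    rw [← Real.Gamma_add_one (by positivity)]; congr 1; ring
  have e2 : Real.Gamma (j + 1 + a) = (j + a) * Real.Gamma (j + a) := by
    rw [← Real.Gamma_add_one (by positivity)]; congr 1; ring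
  rw [betaF, betaF, sourceTerm, leadingConst, e1, e2,
    show (j : ℝ) + a + (a + 2) = j + 2 + 2 * a by ring, show a + (a + 1) = 2 * a + 1 by ring]
  field_simp
  ring

/-- Passing from the normalisation by `Γ(k+a+2)/Γ(k)` to the one by a power of `k`. -/
lemma exists_abs_sub_rpow_le {a C₀ K : ℝ} (ha : 0 < a) (hC₀ : 0 < C₀) (hK : 0 < K) {m : ℕ}
    {S : ℕ → ℝ}
    (h : ∀ N : ℕ, 0 < N →
      |S N * (N * gammaRatio (N + 1) (a + 1)) - C₀ * N| ≤ K * harmonicSum N ^ m) :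
    ∃ C > 0, ∃ k₀ : ℕ, ∀ k : ℕ, k₀ ≤ k →
      |S k - C₀ * (k : ℝ) ^ (-(a + 1))| ≤
        C₀ * (k : ℝ) ^ (-(a + 1)) * (C * Real.log k ^ m / (k : ℝ)) := by
  have hO := gammaRatio_div_rpow_sub_one_isBigO (show 0 ≤ a + 2 by positivity)
  have hlim : ∀ᶠ n : ℕ in atTop, |gammaRatio n (a + 2) / (n : ℝ) ^ (a + 2) - 1| < 1 / 2 := by
    have := (hO.trans_tendsto tendsto_one_div_atTop_nhds_zero_nat).abs
    rw [abs_zero] at this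
    exact this.eventually (gt_mem_nhds (by norm_num))
  obtain ⟨K', hK', hb⟩ := bound_of_isBigO_nat_atTop hO
  obtain ⟨k₀, hk₀⟩ := eventually_atTop.1 hlim
  refine ⟨2 * (K * 2 ^ m + C₀ * K') / C₀, by positivity, max k₀ 3, fun k hk => ?_⟩
  have hk3 : 3 ≤ k := (le_max_right _ _).trans hk
  have hkpos : 0 < k := by omega
  have hk : (0 : ℝ) < k := by exact_mod_cast hkpos
  have hlog : 1 ≤ Real.log k := by
    rw [Real.le_log_iff_exp_le hk]
    have : (3 : ℝ) ≤ k := by exact_mod_cast hk3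
    linarith [Real.exp_one_lt_d9]
  set ρ := gammaRatio k (a + 2) / (k : ℝ) ^ (a + 2) with hρ
  have hρ1 : |ρ - 1| ≤ K' * (1 / k) := by
    have := hb (x := k) (by positivity)
    rwa [Real.norm_eq_abs, Real.norm_eq_abs,
      abs_of_pos (show (0 : ℝ) < 1 / (k : ℝ) by positivity)] at this
  have hρ2 : 1 / 2 < ρ := by
    have := (abs_lt.1 (hk₀ k (by omega))).1
    linarith
  have hpow : (k : ℝ) ^ (a + 2) = k * (k : ℝ) ^ (a + 1) := by
    rw [show a + 2 = a + 1 + 1 by ring, Real.rpow_add_one hk.ne']; ring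
  have hratio : k * gammaRatio (k + 1) (a + 1) = ρ * (k * (k : ℝ) ^ (a + 1)) := by
    have e := mul_gammaRatio_add_one_sub_one (x := (k : ℝ)) (s := a + 2) hk
    rw [show a + 2 - 1 = a + 1 by ring] at e
    rw [e, hρ, ← hpow]
    field_simp
  have hN := h k hkpos
  rw [hratio] at hN
  have hψ : harmonicSum k ^ m ≤ 2 ^ m * Real.log k ^ m := by
    rw [← mul_pow]
    have h0 := zero_le_one.trans (one_le_harmonicSum hkpos)
    have := harmonicSum_le_one_add_log k
    gcongr
    linarith
  set T := (k : ℝ) ^ (a + 1) with hT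
  have hTpos : 0 < T := by positivity
  have hlogm : 1 ≤ Real.log k ^ m := one_le_pow₀ hlog
  have hmain : |(S k - C₀ * T⁻¹) * (ρ * (k * T))| ≤ (K * 2 ^ m + C₀ * K') * Real.log k ^ m := by
    have e : (S k - C₀ * T⁻¹) * (ρ * (k * T)) =
        (S k * (ρ * (k * T)) - C₀ * k) + C₀ * k * (1 - ρ) := by
      field_simp
      ring
    rw [e]
    refine (abs_add_le _ _).trans ?_
    have h1 : |C₀ * k * (1 - ρ)| ≤ C₀ * K' := by
      rw [abs_mul, abs_of_pos (by positivity), abs_sub_comm]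
      calc C₀ * k * |ρ - 1| ≤ C₀ * k * (K' * (1 / k)) := by gcongr
        _ = C₀ * K' := by field_simp
    have h2 : K * harmonicSum k ^ m ≤ K * (2 ^ m * Real.log k ^ m) := by gcongr
    have h3 : C₀ * K' ≤ C₀ * K' * Real.log k ^ m := le_mul_of_one_le_right (by positivity) hlogm
    linarith
  rw [abs_mul, abs_of_pos (show 0 < ρ * (k * T) by positivity)] at hmain
  have hhalf : |S k - C₀ * T⁻¹| * (1 / 2 * (k * T)) ≤
      (K * 2 ^ m + C₀ * K') * Real.log k ^ m := le_trans (by gcongr) hmain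
  rw [Real.rpow_neg hk.le, ← hT]
  calc |S k - C₀ * T⁻¹| = |S k - C₀ * T⁻¹| * (1 / 2 * (k * T)) / (1 / 2 * (k * T)) := by
        field_simp
    _ ≤ (K * 2 ^ m + C₀ * K') * Real.log k ^ m / (1 / 2 * (k * T)) := by gcongr
    _ = _ := by field_simp

theorem clk_sum_asymptotic (a : ℝ) (ha : 0 < a) (c : ℕ → ℕ → ℝ)
    (h00 : ∀ l : ℕ, c l 0 = 0) (h0k : ∀ k : ℕ, c 0 k = 0)
    (h1 : ∀ k : ℕ, 1 ≤ k →
      c 1 k = c 1 (k - 1) * ((a + (k : ℝ) - 1) / ((k : ℝ) + 3 * a + 1)) +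
        (betaF ((k : ℝ) - 1 + a) (a + 2) / betaF a (a + 1)) *
          ((a + (k : ℝ) - 1) / ((k : ℝ) + 3 * a + 1)))
    (hl : ∀ l k : ℕ, 2 ≤ l → 1 ≤ k →
      c l k = c l (k - 1) *
          ((a * (l : ℝ) + (k : ℝ) - 1) / ((l : ℝ) * (1 + a) + (k : ℝ) + 2 * a)) +
        c (l - 1) k *
          (((l : ℝ) - 2 + a) / ((l : ℝ) * (1 + a) + (k : ℝ) + 2 * a))) :
    ∃ C > 0, ∃ K : ℕ, ∀ k : ℕ, K ≤ k →
      |(∑' l : ℕ, c l k) -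
          (a + 1) * Real.Gamma (2 * a + 1) / Real.Gamma a * (k : ℝ) ^ (-(a + 1))| ≤
        (a + 1) * Real.Gamma (2 * a + 1) / Real.Gamma a * (k : ℝ) ^ (-(a + 1)) *
          (C * Real.log k ^ (⌈a + 1⌉₊) / (k : ℝ)) := by
  have hrec : IsEdgeRecurrence a (sourceTerm a) c := by
    refine ⟨h00, h0k, fun i j => ?_⟩
    have hD : ((i : ℝ) + 1) * (1 + a) + (j + 1) + 2 * a ≠ 0 := by positivity
    rcases Nat.eq_zero_or_pos i with rfl | hi
    · have h := h1 (j + 1) (by omega)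
      have e := betaF_ratio_mul ha j
      push_cast at h
      rw [show (j : ℝ) + 1 - 1 + a = j + a by ring, show a + ((j : ℝ) + 1) - 1 = a + j by ring] at h
      have hD' : (j : ℝ) + 1 + 3 * a + 1 ≠ 0 := by positivity
      simp only [zero_add, h0k, if_true, Nat.cast_zero, zero_mul, add_zero, one_mul, mul_one]
      rw [h, ← e]
      generalize betaF (j + a) (a + 2) / betaF a (a + 1) = q
      field_simp
      ring
    · have h := hl (i + 1) (j + 1) (by omega) (by omega)
      push_cast at h
      rw [h, if_neg hi.ne']
      field_simp
      ring
  obtain ⟨K, hK, hsum⟩ := hrec.exists_abs_tsum_mul_sub_le ha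
  rw [Nat.ceil_add_one ha.le]
  exact exists_abs_sub_rpow_le ha (leadingConst_pos ha) hK hsum
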